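/- Let 0 < α < n, 1 ≤ p < ∞ with α < n/p, and 1 ≤ q ≤ ∞. If f ∈ L^{n/(n−α),∞}(ℝⁿ) and φ ∈ L^{p,q}(ℝⁿ), then f∗φ ∈ L^{r,q}(ℝⁿ), where 1/r = 1/p − α/n, and ‖f∗φ‖_{r,q} ≤ 3 r ‖f‖_{n/(n−α),∞} ‖φ‖_{p,q}. -/

import Mathlib

open MeasureTheory Set
open scoped ENNReal

/-- Distribution function: `μ {x : |f x| > s}`. -/
noncomputable def distrib {X : Type*} [MeasurableSpace X] (μ : Measure X)
    (f : X → ℝ) (s : ℝ) : ℝ≥0∞ :=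
  μ {x | s < |f x|}

/-- Decreasing rearrangement: `f*(t) = inf {s > 0 : λ_f(s) ≤ t}`. -/
noncomputable def rearr {X : Type*} [MeasurableSpace X] (μ : Measure X)
    (f : X → ℝ) (t : ℝ) : ℝ≥0∞ :=
  ⨅ (s : ℝ) (_ : 0 < s ∧ distrib μ f s ≤ ENNReal.ofReal t), ENNReal.ofReal s

/-- Maximal function `f**(t) = (1/t) ∫₀ᵗ f*(u) du`. -/
noncomputable def maxFn {X : Type*} [MeasurableSpace X] (μ : Measure X)
    (f : X → ℝ) (t : ℝ) : ℝ≥0∞ :=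
  (ENNReal.ofReal t)⁻¹ * ∫⁻ u in Set.Ioc (0:ℝ) t, rearr μ f u

/-- Lorentz norm `‖f‖_{p,q}`; for `q = ∞` it is `sup_{t>0} t^{1/p} f**(t)`. -/
noncomputable def lorentzNorm {X : Type*} [MeasurableSpace X] (μ : Measure X)
    (f : X → ℝ) (p : ℝ) (q : ℝ≥0∞) : ℝ≥0∞ :=
  if q = ⊤ then ⨆ (t : ℝ) (_ : 0 < t), ENNReal.ofReal t ^ (1/p) * maxFn μ f t
  else (∫⁻ t in Set.Ioi (0:ℝ),
      (ENNReal.ofReal t ^ (1/p) * maxFn μ f t) ^ q.toReal * (ENNReal.ofReal t)⁻¹) ^ (1 / q.toReal)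

/-- Convolution on ℝⁿ: `(f ∗ g)(x) = ∫ f(x-y) g(y) dy`. -/
noncomputable def conv {n : ℕ} (f g : EuclideanSpace ℝ (Fin n) → ℝ)
    (x : EuclideanSpace ℝ (Fin n)) : ℝ :=
  ∫ y, f (x - y) * g y

/-- `‖f‖_p = (∫ |f|^p dμ)^{1/p}`. -/
noncomputable def lpNorm {X : Type*} [MeasurableSpace X] (μ : Measure X)
    (f : X → ℝ) (p : ℝ) : ℝ≥0∞ :=
  (∫⁻ x, ENNReal.ofReal |f x| ^ p ∂μ) ^ (1/p)

/-- Riesz potential `I_α f(x) = ∫ |x-y|^{α-n} f(y) dy` on ℝⁿ. -/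
noncomputable def riesz (n : ℕ) (α : ℝ) (f : EuclideanSpace ℝ (Fin n) → ℝ)
    (x : EuclideanSpace ℝ (Fin n)) : ℝ :=
  ∫ y, ‖x - y‖ ^ (α - (n:ℝ)) * f y

/-- Length of the superlevel initial segment `{a > 0 : a < M}`. -/
theorem lintegral_indicator_ofReal_lt (M : ℝ≥0∞) :
    ∫⁻ a in Ioi (0:ℝ), {a : ℝ | ENNReal.ofReal a < M}.indicator 1 a = M := by
  have hm : MeasurableSet {a : ℝ | ENNReal.ofReal a < M} :=
    measurableSet_lt ENNReal.measurable_ofReal measurable_const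
  rw [lintegral_indicator_one hm, Measure.restrict_apply hm]
  rcases eq_or_ne M ⊤ with rfl | hM
  · simp
  · have : {a : ℝ | ENNReal.ofReal a < M} ∩ Ioi 0 = Ioo 0 M.toReal := by
      ext a
      simp only [mem_inter_iff, mem_ofPred_eq, mem_Ioi, mem_Ioo]
      constructor
      · rintro ⟨h, h0⟩
        exact ⟨h0, (ENNReal.ofReal_lt_iff_lt_toReal h0.le hM).1 h⟩
      · rintro ⟨h0, h⟩
        exact ⟨(ENNReal.ofReal_lt_iff_lt_toReal h0.le hM).2 h, h0⟩
    rw [this, Real.volume_Ioo, sub_zero, ENNReal.ofReal_toReal hM]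

theorem antitone_distrib {X : Type*} [MeasurableSpace X] (μ : Measure X) (f : X → ℝ) :
    Antitone (distrib μ f) :=
  fun _ _ h => measure_mono fun _ hx => lt_of_le_of_lt h hx

theorem measurable_maxFn {X : Type*} [MeasurableSpace X] (μ : Measure X) (f : X → ℝ) :
    Measurable (maxFn μ f) := by
  have h : Monotone fun t : ℝ => ∫⁻ u in Set.Ioc (0:ℝ) t, rearr μ f u :=
    fun s t hst => lintegral_mono_set (Ioc_subset_Ioc_right hst)
  exact ENNReal.measurable_ofReal.inv.mul h.measurable

theorem ofReal_le_rearr {X : Type*} [MeasurableSpace X] {μ : Measure X} {f : X → ℝ} {a u : ℝ}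
    (h : ENNReal.ofReal u < distrib μ f a) : ENNReal.ofReal a ≤ rearr μ f u := by
  refine le_iInf₂ fun s hs => ENNReal.ofReal_le_ofReal ?_
  by_contra! hsa
  exact absurd (h.trans_le (antitone_distrib μ f hsa.le)) hs.2.not_gt

/-- One half of the layer cake formula `∫₀ᵗ f* = ∫₀^∞ min (λ_f a) t da`. -/
theorem lintegral_min_distrib_le {X : Type*} [MeasurableSpace X] (μ : Measure X) (f : X → ℝ)
    (t : ℝ) :
    ∫⁻ a in Ioi (0:ℝ), min (distrib μ f a) (ENNReal.ofReal t) ≤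
      ∫⁻ u in Ioc (0:ℝ) t, rearr μ f u := by
  set E : Set (ℝ × ℝ) := {z | ENNReal.ofReal z.2 < distrib μ f z.1}
  have hE : MeasurableSet E := measurableSet_lt (ENNReal.measurable_ofReal.comp measurable_snd)
    ((antitone_distrib μ f).measurable.comp measurable_fst)
  calc ∫⁻ a in Ioi (0:ℝ), min (distrib μ f a) (ENNReal.ofReal t)
      ≤ ∫⁻ a in Ioi (0:ℝ), ∫⁻ u in Ioc (0:ℝ) t, E.indicator 1 (a, u) := by
        refine lintegral_mono fun a => ?_
        rw [← lintegral_indicator_ofReal_lt (min (distrib μ f a) (ENNReal.ofReal t)),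
          ← lintegral_indicator measurableSet_Ioi, ← lintegral_indicator measurableSet_Ioc]
        refine lintegral_mono fun u => ?_
        by_cases hu : 0 < u ∧ ENNReal.ofReal u < min (distrib μ f a) (ENNReal.ofReal t)
        · have hE' : (a, u) ∈ E := (lt_min_iff.1 hu.2).1
          have hut : u ∈ Ioc 0 t :=
            ⟨hu.1, ((ENNReal.ofReal_lt_ofReal_iff_of_nonneg hu.1.le).1 (lt_min_iff.1 hu.2).2).le⟩
          rw [indicator_of_mem hut, indicator_of_mem hE']
          exact indicator_le_self' (fun _ _ => zero_le) u |>.trans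
            (indicator_le_self' (fun _ _ => zero_le) u)
        · rw [indicator_indicator, indicator_of_notMem (fun h => hu ⟨h.1, h.2⟩)]
          exact zero_le
    _ = ∫⁻ u in Ioc (0:ℝ) t, ∫⁻ a in Ioi (0:ℝ), E.indicator 1 (a, u) :=
        lintegral_lintegral_swap (measurable_one.indicator hE).aemeasurable
    _ ≤ ∫⁻ u in Ioc (0:ℝ) t, rearr μ f u := by
        refine lintegral_mono fun u => le_of_forall_gt_imp_ge_of_dense fun R hR => ?_
        rw [← lintegral_indicator_ofReal_lt R]
        refine lintegral_mono fun a => ?_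
        by_cases ha : (a, u) ∈ E
        · have : a ∈ {a : ℝ | ENNReal.ofReal a < R} := (ofReal_le_rearr ha).trans_lt hR
          rw [indicator_of_mem ha, indicator_of_mem this]
          rfl
        · rw [indicator_of_notMem ha]
          exact zero_le

theorem lintegral_min_distrib_le_maxFn {X : Type*} [MeasurableSpace X] (μ : Measure X)
    (f : X → ℝ) {t : ℝ} (ht : 0 < t) :
    ∫⁻ a in Ioi (0:ℝ), min (distrib μ f a) (ENNReal.ofReal t) ≤
      ENNReal.ofReal t * maxFn μ f t := by
  rw [maxFn, ← mul_assoc, ENNReal.mul_inv_cancel (by simpa using ht) ENNReal.ofReal_ne_top,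
    one_mul]
  exact lintegral_min_distrib_le μ f t

/-- If `|h| ≤ g + C` then `∫₀ᵗ h* ≤ ∫ g + C t`. -/
theorem lintegral_rearr_le_of_le_add {X : Type*} [MeasurableSpace X] {μ : Measure X} [SFinite μ]
    {h : X → ℝ} {g : X → ℝ≥0∞} {C : ℝ≥0∞} (hg : Measurable g)
    (hle : ∀ x, ENNReal.ofReal |h x| ≤ g x + C) {t : ℝ} (ht : 0 < t) :
    ∫⁻ u in Ioc (0:ℝ) t, rearr μ h u ≤ (∫⁻ x, g x ∂μ) + C * ENNReal.ofReal t := by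
  rcases eq_or_ne C ⊤ with rfl | hC
  · rw [ENNReal.top_mul (by simpa using ht)]
    simp
  set D : ℝ → ℝ≥0∞ := fun s => μ {x | ENNReal.ofReal s < g x}
  have hDanti : Antitone D := fun s s' hs => measure_mono fun x hx =>
    lt_of_le_of_lt (ENNReal.ofReal_le_ofReal hs) hx
  set E : Set (ℝ × ℝ) := {z | ENNReal.ofReal z.2 < D z.1}
  have hE : MeasurableSet E := measurableSet_lt (ENNReal.measurable_ofReal.comp measurable_snd)
    (hDanti.measurable.comp measurable_fst)
  have hpt : ∀ u, rearr μ h u ≤ (∫⁻ s in Ioi (0:ℝ), E.indicator 1 (s, u)) + C := by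
    intro u
    set I := ∫⁻ s in Ioi (0:ℝ), E.indicator (1 : ℝ × ℝ → ℝ≥0∞) (s, u)
    refine le_of_forall_gt_imp_ge_of_dense fun R hR => ?_
    rcases eq_or_ne R ⊤ with rfl | hRt
    · exact le_top
    have hCR : C < R := lt_of_le_of_lt le_add_self hR
    have hI : I < R - C := lt_tsub_iff_right.2 hR
    have hs0 : 0 < (R - C).toReal :=
      ENNReal.toReal_pos (ne_of_gt (lt_of_le_of_lt zero_le hI)) (by finiteness)
    have hRpos : 0 < R.toReal := ENNReal.toReal_pos (ne_of_gt (lt_of_le_of_lt zero_le hCR)) hRt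
    have hDs : D (R - C).toReal ≤ ENNReal.ofReal u := by
      by_contra! hlt
      refine hI.not_ge ?_
      rw [← lintegral_indicator_ofReal_lt (R - C)]
      refine setLIntegral_mono' measurableSet_Ioi fun s hs => ?_
      by_cases hsR : s ∈ {a : ℝ | ENNReal.ofReal a < R - C}
      · have : (s, u) ∈ E := hlt.trans_le (hDanti
          ((ENNReal.ofReal_lt_iff_lt_toReal (le_of_lt hs) (by finiteness)).1 hsR).le)
        rw [indicator_of_mem this]
        exact indicator_le_self' (fun _ _ => zero_le) s
      · rw [indicator_of_notMem hsR]
        exact zero_le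
    refine (iInf₂_le R.toReal ⟨hRpos, ?_⟩).trans (ENNReal.ofReal_toReal hRt).le
    refine (measure_mono fun x hx => ?_).trans hDs
    rw [mem_ofPred_eq] at hx ⊢
    rw [ENNReal.ofReal_toReal (by finiteness)]
    have h1 : R < ENNReal.ofReal |h x| := (ENNReal.lt_ofReal_iff_toReal_lt hRt).2 hx
    exact ENNReal.sub_lt_of_lt_add hCR.le (h1.trans_le (hle x))
  have hmE : Measurable fun u : ℝ => ∫⁻ s in Ioi (0:ℝ), E.indicator (1 : ℝ × ℝ → ℝ≥0∞) (s, u) :=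
    (measurable_one.indicator hE).lintegral_prod_left'
  set G : Set (ℝ × X) := {z | ENNReal.ofReal z.1 < g z.2}
  have hG : MeasurableSet G := measurableSet_lt (ENNReal.measurable_ofReal.comp measurable_fst)
    (hg.comp measurable_snd)
  calc ∫⁻ u in Ioc (0:ℝ) t, rearr μ h u
      ≤ ∫⁻ u in Ioc (0:ℝ) t, ((∫⁻ s in Ioi (0:ℝ), E.indicator 1 (s, u)) + C) := lintegral_mono hpt
    _ = (∫⁻ u in Ioc (0:ℝ) t, ∫⁻ s in Ioi (0:ℝ), E.indicator 1 (s, u)) + C * ENNReal.ofReal t := by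
        rw [lintegral_add_left hmE]
        simp
    _ ≤ (∫⁻ u in Ioi (0:ℝ), ∫⁻ s in Ioi (0:ℝ), E.indicator 1 (s, u)) + C * ENNReal.ofReal t := by
        gcongr
        exact Ioc_subset_Ioi_self
    _ = (∫⁻ s in Ioi (0:ℝ), D s) + C * ENNReal.ofReal t := by
        rw [lintegral_lintegral_swap (f := fun u s => E.indicator 1 (s, u))
          ((measurable_one.indicator hE).comp measurable_swap).aemeasurable]
        congr 2 with s
        exact lintegral_indicator_ofReal_lt (D s)
    _ = (∫⁻ s in Ioi (0:ℝ), ∫⁻ x, G.indicator 1 (s, x) ∂μ) + C * ENNReal.ofReal t := by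
        congr 2 with s
        exact (lintegral_indicator_one (measurableSet_lt measurable_const hg)).symm
    _ = (∫⁻ x, g x ∂μ) + C * ENNReal.ofReal t := by
        rw [lintegral_lintegral_swap (f := fun s x => G.indicator 1 (s, x))
          (measurable_one.indicator hG).aemeasurable]
        congr 2 with x
        exact lintegral_indicator_ofReal_lt (g x)

/-- Jensen's inequality for a weighted integral. -/
theorem rpow_lintegral_mul_le {X : Type*} [MeasurableSpace X] {μ : Measure X} {K w : X → ℝ≥0∞}
    (hK : Measurable K) (hw : Measurable w) {q : ℝ} (hq : 1 ≤ q) :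
    (∫⁻ x, K x * w x ∂μ) ^ q ≤ (∫⁻ x, w x ∂μ) ^ (q - 1) * ∫⁻ x, K x ^ q * w x ∂μ := by
  have hq0 : 0 < q := by linarith
  have hq1 : 0 ≤ 1 - 1 / q := by
    rw [sub_nonneg, div_le_one hq0]
    exact hq
  have key := ENNReal.lintegral_mul_norm_pow_le (μ := μ) (f := fun x => K x ^ q * w x) (g := w)
    ((hK.pow_const q).mul hw).aemeasurable hw.aemeasurable (p := 1 / q) (q := 1 - 1 / q)
    (by positivity) hq1 (by ring)
  have hpt : ∀ x, (K x ^ q * w x) ^ (1 / q) * w x ^ (1 - 1 / q) = K x * w x := by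
    intro x
    rw [ENNReal.mul_rpow_of_nonneg _ _ (by positivity), ← ENNReal.rpow_mul,
      mul_one_div_cancel hq0.ne', ENNReal.rpow_one, mul_assoc,
      ← ENNReal.rpow_add_of_nonneg _ _ (by positivity) hq1]
    simp
  simp only [hpt] at key
  calc (∫⁻ x, K x * w x ∂μ) ^ q
      ≤ ((∫⁻ x, K x ^ q * w x ∂μ) ^ (1 / q) * (∫⁻ x, w x ∂μ) ^ (1 - 1 / q)) ^ q := by gcongr
    _ = _ := by
        rw [ENNReal.mul_rpow_of_nonneg _ _ hq0.le, ← ENNReal.rpow_mul, ← ENNReal.rpow_mul,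
          one_div_mul_cancel hq0.ne', ENNReal.rpow_one, mul_comm,
          show (1 - 1 / q) * q = q - 1 by field_simp]

theorem lintegral_Ioi_rpow_mul_inv {β t : ℝ} (hβ : 0 < β) (ht : 0 < t) :
    ∫⁻ s in Ioi t, ENNReal.ofReal s ^ (-β) * (ENNReal.ofReal s)⁻¹ =
      ENNReal.ofReal t ^ (-β) * ENNReal.ofReal (1 / β) := by
  have h1 : ∀ s ∈ Ioi t, ENNReal.ofReal s ^ (-β) * (ENNReal.ofReal s)⁻¹ =
      ENNReal.ofReal (s ^ (-β - 1)) := by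
    intro s hs
    have hs0 : 0 < s := ht.trans hs
    rw [← ENNReal.rpow_neg_one, ← ENNReal.rpow_add _ _ (by simpa using hs0) (by finiteness),
      ENNReal.ofReal_rpow_of_pos hs0, sub_eq_add_neg]
  rw [setLIntegral_congr_fun measurableSet_Ioi h1,
    ← ofReal_integral_eq_lintegral_ofReal (integrableOn_Ioi_rpow_of_lt (by linarith) ht)
      ((ae_restrict_iff' measurableSet_Ioi).2 (ae_of_all _ fun s hs =>
        Real.rpow_nonneg (ht.trans hs).le _)),
    integral_Ioi_rpow_of_lt (by linarith) ht, ENNReal.ofReal_rpow_of_pos ht,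
    ← ENNReal.ofReal_mul (by positivity)]
  congr 1
  rw [show -β - 1 + 1 = -β by ring]
  field_simp

theorem lintegral_Ioo_rpow_mul_inv {β s : ℝ} (hβ : 0 < β) (hs : 0 < s) :
    ∫⁻ t in Ioo 0 s, ENNReal.ofReal t ^ β * (ENNReal.ofReal t)⁻¹ =
      ENNReal.ofReal s ^ β * ENNReal.ofReal (1 / β) := by
  have h1 : ∀ t ∈ Ioo 0 s, ENNReal.ofReal t ^ β * (ENNReal.ofReal t)⁻¹ =
      ENNReal.ofReal (t ^ (β - 1)) := by
    intro t ht
    have ht0 : 0 < t := ht.1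
    rw [← ENNReal.rpow_neg_one, ← ENNReal.rpow_add _ _ (by simpa using ht0) (by finiteness),
      ENNReal.ofReal_rpow_of_pos ht0, sub_eq_add_neg]
  have hint : IntegrableOn (fun t : ℝ => t ^ (β - 1)) (Ioo 0 s) :=
    (intervalIntegral.integrableOn_Ioo_rpow_iff hs).2 (by linarith)
  rw [setLIntegral_congr_fun measurableSet_Ioo h1,
    ← ofReal_integral_eq_lintegral_ofReal hint
      ((ae_restrict_iff' measurableSet_Ioo).2 (ae_of_all _ fun t ht =>
        Real.rpow_nonneg ht.1.le _)),
    ← integral_Ioc_eq_integral_Ioo, ← intervalIntegral.integral_of_le hs.le,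
    integral_rpow (Or.inl (by linarith)), ENNReal.ofReal_rpow_of_pos hs,
    ← ENNReal.ofReal_mul (by positivity)]
  congr 1
  rw [show β - 1 + 1 = β by ring, Real.zero_rpow hβ.ne']
  field_simp
  ring

/-- Hardy's inequality for `t ↦ t^β ∫ₜ^∞ s^{-β} K(s) ds/s` on `L^q(dt/t)`. -/
theorem lintegral_hardy_le {K : ℝ → ℝ≥0∞} (hK : Measurable K) {β q : ℝ} (hβ : 0 < β)
    (hq : 1 ≤ q) :
    ∫⁻ t in Ioi (0:ℝ), (ENNReal.ofReal t ^ β *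
        ∫⁻ s in Ioi t, K s * (ENNReal.ofReal s ^ (-β) * (ENNReal.ofReal s)⁻¹)) ^ q *
          (ENNReal.ofReal t)⁻¹ ≤
      ENNReal.ofReal (1 / β) ^ q * ∫⁻ s in Ioi (0:ℝ), K s ^ q * (ENNReal.ofReal s)⁻¹ := by
  set w : ℝ → ℝ≥0∞ := fun s => ENNReal.ofReal s ^ (-β) * (ENNReal.ofReal s)⁻¹ with hw
  set v : ℝ → ℝ≥0∞ := fun t => ENNReal.ofReal t ^ β * (ENNReal.ofReal t)⁻¹ with hv
  have hwm : Measurable w := by fun_prop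
  have hvm : Measurable v := by fun_prop
  set c := ENNReal.ofReal (1 / β)
  have hq0 : 0 < q := by linarith
  set E : Set (ℝ × ℝ) := {z | z.1 < z.2}
  have hE : MeasurableSet E := measurableSet_lt measurable_fst measurable_snd
  set F : ℝ → ℝ → ℝ≥0∞ := fun t s => E.indicator (fun z => v z.1 * (K z.2 ^ q * w z.2)) (t, s)
  have hF : Measurable (Function.uncurry F) := by
    refine Measurable.indicator ?_ hE
    fun_prop
  have hcomb : ∀ t : ℝ, 0 < t → (ENNReal.ofReal t ^ β * ∫⁻ s in Ioi t, K s * w s) ^ q *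
      (ENNReal.ofReal t)⁻¹ ≤ c ^ (q - 1) * ∫⁻ s in Ioi (0:ℝ), F t s := by
    intro t ht
    have hFt : ∫⁻ s in Ioi (0:ℝ), F t s = v t * ∫⁻ s in Ioi t, K s ^ q * w s := by
      rw [← lintegral_const_mul _ (by fun_prop), ← lintegral_indicator measurableSet_Ioi,
        ← lintegral_indicator measurableSet_Ioi]
      congr 1 with s
      by_cases hs : t < s
      · have hs' : s ∈ Ioi t := hs
        have hs0 : s ∈ Ioi (0:ℝ) := ht.trans hs
        have hE' : (t, s) ∈ E := hs
        rw [indicator_of_mem hs', indicator_of_mem hs0]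
        simp only [F]
        rw [indicator_of_mem hE']
      · have hs' : s ∉ Ioi t := hs
        have hE' : (t, s) ∉ E := hs
        rw [indicator_of_notMem hs', indicator_apply_eq_zero]
        intro
        simp only [F]
        rw [indicator_of_notMem hE']
    have ht0 : ENNReal.ofReal t ≠ 0 := by simpa using ht
    have htp : ENNReal.ofReal t ^ (β * q) * ENNReal.ofReal t ^ (-β * (q - 1)) =
        ENNReal.ofReal t ^ β := by
      rw [← ENNReal.rpow_add _ _ ht0 (by finiteness)]
      congr 1
      ring
    calc (ENNReal.ofReal t ^ β * ∫⁻ s in Ioi t, K s * w s) ^ q * (ENNReal.ofReal t)⁻¹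
        = ENNReal.ofReal t ^ (β * q) * (∫⁻ s in Ioi t, K s * w s) ^ q *
            (ENNReal.ofReal t)⁻¹ := by
          rw [ENNReal.mul_rpow_of_nonneg _ _ hq0.le, ← ENNReal.rpow_mul]
      _ ≤ ENNReal.ofReal t ^ (β * q) * ((ENNReal.ofReal t ^ (-β) * c) ^ (q - 1) *
            ∫⁻ s in Ioi t, K s ^ q * w s) * (ENNReal.ofReal t)⁻¹ := by
          gcongr
          refine (rpow_lintegral_mul_le hK hwm hq).trans_eq ?_
          rw [lintegral_Ioi_rpow_mul_inv hβ ht]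
      _ = c ^ (q - 1) * ∫⁻ s in Ioi (0:ℝ), F t s := by
          rw [hFt, ENNReal.mul_rpow_of_nonneg _ _ (by linarith), ← ENNReal.rpow_mul]
          simp only [hv]
          rw [← htp]
          ring
  calc _ ≤ ∫⁻ t in Ioi (0:ℝ), c ^ (q - 1) * ∫⁻ s in Ioi (0:ℝ), F t s :=
        setLIntegral_mono' measurableSet_Ioi hcomb
    _ = c ^ (q - 1) * ∫⁻ s in Ioi (0:ℝ), ∫⁻ t in Ioi (0:ℝ), F t s := by
        rw [lintegral_const_mul (f := fun t => ∫⁻ s in Ioi (0:ℝ), F t s) _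
          hF.lintegral_prod_right', lintegral_lintegral_swap hF.aemeasurable]
    _ = c ^ (q - 1) * ∫⁻ s in Ioi (0:ℝ), c * (K s ^ q * (ENNReal.ofReal s)⁻¹) := by
        congr 1
        refine setLIntegral_congr_fun measurableSet_Ioi fun s hs => ?_
        have hs0 : (0:ℝ) < s := hs
        have : ∫⁻ t in Ioi (0:ℝ), F t s = ∫⁻ t in Ioo 0 s, v t * (K s ^ q * w s) := by
          rw [← lintegral_indicator measurableSet_Ioi, ← lintegral_indicator measurableSet_Ioo]
          congr 1 with t
          by_cases ht : t < s
          · have hE' : (t, s) ∈ E := ht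
            by_cases ht0 : 0 < t
            · have h1 : t ∈ Ioi (0:ℝ) := ht0
              have h2 : t ∈ Ioo 0 s := ⟨ht0, ht⟩
              rw [indicator_of_mem h1, indicator_of_mem h2]
              simp only [F]
              rw [indicator_of_mem hE']
            · have h1 : t ∉ Ioi (0:ℝ) := ht0
              have h2 : t ∉ Ioo 0 s := fun h => ht0 h.1
              rw [indicator_of_notMem h1, indicator_of_notMem h2]
          · have hE' : (t, s) ∉ E := ht
            have h2 : t ∉ Ioo 0 s := fun h => ht h.2
            rw [indicator_of_notMem h2, indicator_apply_eq_zero]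
            intro
            simp only [F]
            rw [indicator_of_notMem hE']
        have hss : ENNReal.ofReal s ^ β * ENNReal.ofReal s ^ (-β) = 1 := by
          rw [← ENNReal.rpow_add _ _ (by simpa using hs0) (by finiteness)]
          simp
        simp only [this]
        rw [lintegral_mul_const _ hvm, lintegral_Ioo_rpow_mul_inv hβ hs0]
        simp only [hw]
        calc _ = c * (K s ^ q * ((ENNReal.ofReal s ^ β * ENNReal.ofReal s ^ (-β)) *
              (ENNReal.ofReal s)⁻¹)) := by ring
          _ = _ := by rw [hss, one_mul]
    _ = _ := by
        rw [lintegral_const_mul _ (by fun_prop), ← mul_assoc]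
        congr 1
        nth_rewrite 2 [← ENNReal.rpow_one c]
        rw [← ENNReal.rpow_add_of_nonneg _ _ (by linarith) zero_le_one, sub_add_cancel]

/-- Extend a bound for truncated integrals of `D` from finite to arbitrary truncation levels. -/
theorem lintegral_min_le_mul_rpow {D : ℝ → ℝ≥0∞} (hD : Measurable D) {A : ℝ≥0∞} {γ : ℝ}
    (hγ : 0 < γ)
    (h : ∀ t : ℝ, 0 < t →
      ∫⁻ a in Ioi (0:ℝ), min (D a) (ENNReal.ofReal t) ≤ A * ENNReal.ofReal t ^ γ)
    (y : ℝ≥0∞) : ∫⁻ a in Ioi (0:ℝ), min (D a) y ≤ A * y ^ γ := by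
  rcases eq_or_ne y 0 with rfl | hy0
  · simp
  rcases eq_or_ne y ⊤ with rfl | hy
  · rcases eq_or_ne A 0 with rfl | hA
    · have h1 : ∫⁻ a in Ioi (0:ℝ), min (D a) (ENNReal.ofReal 1) = 0 := by
        simpa using h 1 one_pos
      rw [lintegral_eq_zero_iff (by fun_prop)] at h1
      have h2 : ∫⁻ a in Ioi (0:ℝ), min (D a) ⊤ = 0 := by
        rw [lintegral_eq_zero_iff (by fun_prop)]
        filter_upwards [h1] with a ha
        simpa using ha
      rw [h2]
      exact zero_le
    · rw [ENNReal.top_rpow_of_pos hγ, ENNReal.mul_top hA]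
      exact le_top
  · have := h y.toReal (ENNReal.toReal_pos hy0 hy)
    rwa [ENNReal.ofReal_toReal hy] at this

theorem lintegral_Ioi_rpow_mul_min_of_le {γ t : ℝ} (hγ0 : 0 < γ) (hγ : γ < 1) (ht : 0 < t)
    {y : ℝ≥0∞} (hy : y ≤ ENNReal.ofReal t) :
    y * ENNReal.ofReal t ^ γ ≤ ENNReal.ofReal t * ∫⁻ s in Ioi t,
      ENNReal.ofReal s ^ (-(1 - γ)) * (ENNReal.ofReal s)⁻¹ * min y (ENNReal.ofReal s) := by
  have h1 : ∫⁻ s in Ioi t, ENNReal.ofReal s ^ (-(1 - γ)) * (ENNReal.ofReal s)⁻¹ *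
      min y (ENNReal.ofReal s) = ∫⁻ s in Ioi t, ENNReal.ofReal s ^ (-(1 - γ)) *
        (ENNReal.ofReal s)⁻¹ * y := by
    refine setLIntegral_congr_fun measurableSet_Ioi fun s hs => ?_
    rw [min_eq_left (hy.trans (ENNReal.ofReal_le_ofReal (le_of_lt hs)))]
  have ht0 : ENNReal.ofReal t ≠ 0 := by simpa using ht
  have h2 : ENNReal.ofReal t * ENNReal.ofReal t ^ (-(1 - γ)) = ENNReal.ofReal t ^ γ := by
    nth_rewrite 1 [← ENNReal.rpow_one (ENNReal.ofReal t)]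
    rw [← ENNReal.rpow_add _ _ ht0 (by finiteness)]
    congr 1
    ring
  have h3 : 1 ≤ ENNReal.ofReal (1 / (1 - γ)) := by
    rw [← ENNReal.ofReal_one]
    refine ENNReal.ofReal_le_ofReal ?_
    rw [le_div_iff₀ (by linarith)]
    linarith
  rw [h1, lintegral_mul_const _ (by fun_prop), lintegral_Ioi_rpow_mul_inv (by linarith) ht]
  calc y * ENNReal.ofReal t ^ γ = ENNReal.ofReal t * ENNReal.ofReal t ^ (-(1 - γ)) * 1 * y := by
        rw [h2]
        ring
    _ ≤ ENNReal.ofReal t * ENNReal.ofReal t ^ (-(1 - γ)) * ENNReal.ofReal (1 / (1 - γ)) * y := by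
        gcongr
    _ = _ := by ring

theorem lintegral_Ioi_rpow_mul_min_of_lt {γ t : ℝ} (hγ0 : 0 < γ) (hγ : γ < 1) (ht : 0 < t)
    {y : ℝ≥0∞} (hy : ENNReal.ofReal t < y) :
    y ^ γ ≤ ∫⁻ s in Ioi t,
      ENNReal.ofReal s ^ (-(1 - γ)) * (ENNReal.ofReal s)⁻¹ * min y (ENNReal.ofReal s) := by
  have key : ∀ x : ℝ, t < x → ENNReal.ofReal x ≤ y → ENNReal.ofReal x ^ γ ≤ ∫⁻ s in Ioi t,
      ENNReal.ofReal s ^ (-(1 - γ)) * (ENNReal.ofReal s)⁻¹ * min y (ENNReal.ofReal s) := by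
    intro x hx hxy
    have hx0 : 0 < x := ht.trans hx
    have hx0' : ENNReal.ofReal x ≠ 0 := by simpa using hx0
    have h := lintegral_Ioi_rpow_mul_min_of_le hγ0 hγ hx0 (le_refl (ENNReal.ofReal x))
    rw [ENNReal.mul_le_mul_iff_right hx0' (by finiteness)] at h
    refine h.trans ((lintegral_mono fun s => ?_).trans (lintegral_mono_set (Ioi_subset_Ioi hx.le)))
    gcongr
  rcases eq_or_ne y ⊤ with rfl | hyt
  · rw [ENNReal.top_rpow_of_pos hγ0]
    refine top_le_iff.2 (ENNReal.eq_top_of_forall_nnreal_le fun N => ?_)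
    set M : ℝ := max (t + 1) ((N : ℝ) ^ (1 / γ))
    refine le_trans ?_ (key M (by simp [M]) le_top)
    have hM : 0 < M := lt_max_of_lt_left (by linarith)
    rw [ENNReal.ofReal_rpow_of_pos hM, ← ENNReal.ofReal_coe_nnreal]
    refine ENNReal.ofReal_le_ofReal ?_
    calc (N : ℝ) = ((N : ℝ) ^ (1 / γ)) ^ γ := by
          rw [← Real.rpow_mul N.coe_nonneg, one_div_mul_cancel hγ0.ne', Real.rpow_one]
      _ ≤ M ^ γ := by
          gcongr
          exact le_max_right _ _
  · have := key y.toReal ((ENNReal.ofReal_lt_iff_lt_toReal ht.le hyt).1 hy)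
      (ENNReal.ofReal_toReal hyt).le
    rwa [ENNReal.ofReal_toReal hyt] at this

theorem lintegral_indicator_lt_abs (r : ℝ) :
    ∫⁻ a in Ioi (0:ℝ), {a : ℝ | a < |r|}.indicator 1 a = ‖r‖ₑ := by
  have hm : MeasurableSet {a : ℝ | a < |r|} := measurableSet_Iio
  have : {a : ℝ | a < |r|} ∩ Ioi 0 = Ioo 0 |r| := by
    ext a
    simp [and_comm]
  rw [lintegral_indicator_one hm, Measure.restrict_apply hm, this, Real.volume_Ioo, sub_zero,
    Real.enorm_eq_ofReal_abs]

/-- O'Neil's inequality in layer cake form. -/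
theorem lintegral_rearr_conv_le {n : ℕ} {f φ : EuclideanSpace ℝ (Fin n) → ℝ} (hf : Measurable f)
    (hφ : Measurable φ) {t : ℝ} (ht : 0 < t) :
    ∫⁻ u in Ioc (0:ℝ) t, rearr volume (conv f φ) u ≤
      ∫⁻ b in Ioi (0:ℝ), ∫⁻ a in Ioi (0:ℝ),
        if distrib volume φ b ≤ ENNReal.ofReal t then
          distrib volume φ b * min (distrib volume f a) (ENNReal.ofReal t)
        else ENNReal.ofReal t * min (distrib volume f a) (distrib volume φ b) := by
  set ν : Measure ℝ := volume.restrict (Ioi 0)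
  set lf := distrib volume f
  set lφ := distrib volume φ
  have hlf : Measurable lf := (antitone_distrib _ _).measurable
  have hlφ : Measurable lφ := (antitone_distrib _ _).measurable
  set τ := ENNReal.ofReal t
  set If : Set (ℝ × EuclideanSpace ℝ (Fin n)) := {z | z.1 < |f z.2|}
  have hIf : MeasurableSet If := measurableSet_lt measurable_fst (by fun_prop)
  set Iφ : Set (ℝ × EuclideanSpace ℝ (Fin n)) := {z | z.1 < |φ z.2|}
  have hIφ : MeasurableSet Iφ := measurableSet_lt measurable_fst (by fun_prop)
  set F : ℝ → EuclideanSpace ℝ (Fin n) → ℝ≥0∞ := fun a x => If.indicator 1 (a, x)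
  set Φ : ℝ → EuclideanSpace ℝ (Fin n) → ℝ≥0∞ := fun b y => Iφ.indicator 1 (b, y)
  have hF : Measurable (Function.uncurry F) := measurable_one.indicator hIf
  have hΦ : Measurable (Function.uncurry Φ) := measurable_one.indicator hIφ
  have hF' : ∀ {Y : Type} [MeasurableSpace Y] {u : Y → ℝ} {v : Y → EuclideanSpace ℝ (Fin n)}, Measurable u →
      Measurable v → Measurable fun y => F (u y) (v y) :=
    fun hu hv => hF.comp (hu.prodMk hv)
  have hΦ' : ∀ {Y : Type} [MeasurableSpace Y] {u : Y → ℝ} {v : Y → EuclideanSpace ℝ (Fin n)}, Measurable u →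
      Measurable v → Measurable fun y => Φ (u y) (v y) :=
    fun hu hv => hΦ.comp (hu.prodMk hv)
  have hF1 : ∀ a x, F a x ≤ 1 := fun a x => indicator_le_self' (fun _ _ => zero_le) _
  have hΦ1 : ∀ a x, Φ a x ≤ 1 := fun a x => indicator_le_self' (fun _ _ => zero_le) _
  have hFint : ∀ a, ∫⁻ x, F a x = lf a := fun a =>
    lintegral_indicator_one (measurableSet_lt measurable_const (by fun_prop))
  have hΦint : ∀ a, ∫⁻ x, Φ a x = lφ a := fun a =>
    lintegral_indicator_one (measurableSet_lt measurable_const (by fun_prop))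
  have hFlayer : ∀ x, ∫⁻ a, F a x ∂ν = ‖f x‖ₑ := fun x => lintegral_indicator_lt_abs (f x)
  have hΦlayer : ∀ x, ∫⁻ a, Φ a x ∂ν = ‖φ x‖ₑ := fun x => lintegral_indicator_lt_abs (φ x)
  set T : ℝ × ℝ → EuclideanSpace ℝ (Fin n) → ℝ≥0∞ := fun z x => ∫⁻ y, F z.1 (x - y) * Φ z.2 y with hT
  have hTm : Measurable (Function.uncurry T) := by
    refine Measurable.lintegral_prod_right' (f := fun w : ((ℝ × ℝ) × EuclideanSpace ℝ (Fin n)) × EuclideanSpace ℝ (Fin n) =>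
      F w.1.1.1 (w.1.2 - w.2) * Φ w.1.1.2 w.2) ?_
    exact (hF' (by fun_prop) (by fun_prop)).mul (hΦ' (by fun_prop) (by fun_prop))
  have hTle : ∀ z x, T z x ≤ min (lf z.1) (lφ z.2) := by
    intro z x
    refine le_min ?_ ?_
    · calc T z x ≤ ∫⁻ y, F z.1 (x - y) := lintegral_mono fun y => mul_le_of_le_one_right' (hΦ1 _ _)
        _ = lf z.1 := by rw [lintegral_sub_left_eq_self (fun y => F z.1 y) x, hFint]
    · calc T z x ≤ ∫⁻ y, Φ z.2 y := lintegral_mono fun y => mul_le_of_le_one_left' (hF1 _ _)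
        _ = lφ z.2 := hΦint _
  have hTint : ∀ z, ∫⁻ x, T z x = lf z.1 * lφ z.2 := by
    intro z
    simp only [hT]
    rw [lintegral_lintegral_swap ((hF' (by fun_prop) (by fun_prop)).mul
      (hΦ' (by fun_prop) (by fun_prop))).aemeasurable]
    have : ∀ y, ∫⁻ x, F z.1 (x - y) * Φ z.2 y = lf z.1 * Φ z.2 y := by
      intro y
      rw [lintegral_mul_const _ (hF' (by fun_prop) (by fun_prop)),
        lintegral_sub_right_eq_self (fun x => F z.1 x) y, hFint]
    simp only [this]
    rw [lintegral_const_mul _ (hΦ' (by fun_prop) (by fun_prop)), hΦint]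
  have hH : ∀ x, ENNReal.ofReal |conv f φ x| ≤ ∫⁻ z, T z x ∂(ν.prod ν) := by
    intro x
    calc ENNReal.ofReal |conv f φ x| = ‖∫ y, f (x - y) * φ y‖ₑ := by
          rw [Real.enorm_eq_ofReal_abs, conv]
      _ ≤ ∫⁻ y, ‖f (x - y) * φ y‖ₑ := enorm_integral_le_lintegral_enorm _
      _ = ∫⁻ y, ∫⁻ z, F z.1 (x - y) * Φ z.2 y ∂(ν.prod ν) := by
          congr 1 with y
          rw [lintegral_prod_mul (f := fun a => F a (x - y)) (g := fun b => Φ b y)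
            (hF' (by fun_prop) (by fun_prop)).aemeasurable
            (hΦ' (by fun_prop) (by fun_prop)).aemeasurable, hFlayer, hΦlayer, enorm_mul]
      _ = ∫⁻ z, T z x ∂(ν.prod ν) :=
          lintegral_lintegral_swap ((hF' (by fun_prop) (by fun_prop)).mul
            (hΦ' (by fun_prop) (by fun_prop))).aemeasurable
  set S : Set (ℝ × ℝ) := {z | max (lf z.1) (lφ z.2) ≤ τ}
  have hS : MeasurableSet S := measurableSet_le (by fun_prop) measurable_const
  have hsplit : ∀ x, ENNReal.ofReal |conv f φ x| ≤ (∫⁻ z in S, T z x ∂(ν.prod ν)) +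
      ∫⁻ z in Sᶜ, min (lf z.1) (lφ z.2) ∂(ν.prod ν) := by
    intro x
    refine (hH x).trans ?_
    rw [← lintegral_add_compl _ hS]
    gcongr
    exact hTle _ _
  set k : ℝ × ℝ → ℝ≥0∞ := fun z =>
    if lφ z.2 ≤ τ then lφ z.2 * min (lf z.1) τ else τ * min (lf z.1) (lφ z.2) with hk
  have hkm : Measurable k :=
    Measurable.ite (measurableSet_le (by fun_prop) measurable_const) (by fun_prop) (by fun_prop)
  calc ∫⁻ u in Ioc (0:ℝ) t, rearr volume (conv f φ) u
      ≤ (∫⁻ x, ∫⁻ z in S, T z x ∂(ν.prod ν)) +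
          (∫⁻ z in Sᶜ, min (lf z.1) (lφ z.2) ∂(ν.prod ν)) * τ :=
        lintegral_rearr_le_of_le_add hTm.lintegral_prod_left' hsplit ht
    _ = (∫⁻ z in S, lf z.1 * lφ z.2 ∂(ν.prod ν)) +
          ∫⁻ z in Sᶜ, min (lf z.1) (lφ z.2) * τ ∂(ν.prod ν) := by
        rw [lintegral_lintegral_swap (f := fun x z => T z x)
            (hTm.comp measurable_swap).aemeasurable,
          lintegral_mul_const _ (by fun_prop)]
        simp only [hTint]
    _ ≤ (∫⁻ z in S, k z ∂(ν.prod ν)) + ∫⁻ z in Sᶜ, k z ∂(ν.prod ν) := by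
        refine add_le_add (setLIntegral_mono' hS fun z hz => ?_)
          (setLIntegral_mono' hS.compl fun z hz => ?_)
        · have hz' : max (lf z.1) (lφ z.2) ≤ τ := hz
          obtain ⟨h1, h2⟩ := max_le_iff.1 hz'
          simp only [hk]
          rw [if_pos h2, min_eq_left h1, mul_comm]
        · simp only [hk]
          split_ifs with h2
          · have h1 : τ ≤ lf z.1 := by
              by_contra! h1
              exact hz (max_le h1.le h2)
            rw [min_eq_right h1]
            gcongr
            exact min_le_right _ _
          · rw [mul_comm]
    _ = ∫⁻ z, k z ∂(ν.prod ν) := lintegral_add_compl _ hS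
    _ = ∫⁻ b, ∫⁻ a, k (a, b) ∂ν ∂ν := lintegral_prod_symm _ hkm.aemeasurable

/-- The maximal function of `f ∗ φ` for `f` in weak `L^{1/(1-γ)}` with constant `A`. -/
theorem maxFn_conv_le {n : ℕ} {f φ : EuclideanSpace ℝ (Fin n) → ℝ} (hf : Measurable f)
    (hφ : Measurable φ) {A : ℝ≥0∞} {γ : ℝ} (hγ0 : 0 < γ) (hγ : γ < 1)
    (hA : ∀ t : ℝ, 0 < t → ENNReal.ofReal t ^ (1 - γ) * maxFn volume f t ≤ A) {t : ℝ}
    (ht : 0 < t) :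
    maxFn volume (conv f φ) t ≤
      A * ∫⁻ s in Ioi t, ENNReal.ofReal s ^ γ * maxFn volume φ s * (ENNReal.ofReal s)⁻¹ := by
  set lf := distrib volume f
  set lφ := distrib volume φ
  have hlf : Measurable lf := (antitone_distrib _ _).measurable
  have hlφ : Measurable lφ := (antitone_distrib _ _).measurable
  have hpow : ∀ s : ℝ, 0 < s → ENNReal.ofReal s * ENNReal.ofReal s ^ (-(1 - γ)) =
      ENNReal.ofReal s ^ γ := by
    intro s hs
    nth_rewrite 1 [← ENNReal.rpow_one (ENNReal.ofReal s)]
    rw [← ENNReal.rpow_add _ _ (by simpa using hs) (by finiteness)]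
    congr 1
    ring
  have hweak := lintegral_min_le_mul_rpow hlf (A := A) hγ0 fun s hs => by
    refine (lintegral_min_distrib_le_maxFn volume f hs).trans ?_
    have h1 : ENNReal.ofReal s ^ γ * ENNReal.ofReal s ^ (1 - γ) = ENNReal.ofReal s := by
      rw [← ENNReal.rpow_add _ _ (by simpa using hs) (by finiteness)]
      simp
    calc ENNReal.ofReal s * maxFn volume f s
        = ENNReal.ofReal s ^ γ * (ENNReal.ofReal s ^ (1 - γ) * maxFn volume f s) := by
          rw [← mul_assoc, h1]
      _ ≤ ENNReal.ofReal s ^ γ * A := by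
          gcongr
          exact hA s hs
      _ = A * ENNReal.ofReal s ^ γ := mul_comm _ _
  set W : ℝ → ℝ≥0∞ := fun s => ENNReal.ofReal s ^ (-(1 - γ)) * (ENNReal.ofReal s)⁻¹ with hW
  set J : ℝ≥0∞ → ℝ≥0∞ := fun y => ∫⁻ s in Ioi t, W s * min y (ENNReal.ofReal s)
  have hWm : Measurable W := by fun_prop
  have ht0 : ENNReal.ofReal t ≠ 0 := by simpa using ht
  have hinner : ∀ b, ∫⁻ a in Ioi (0:ℝ),
      (if lφ b ≤ ENNReal.ofReal t then lφ b * min (lf a) (ENNReal.ofReal t)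
        else ENNReal.ofReal t * min (lf a) (lφ b)) ≤ A * ENNReal.ofReal t * J (lφ b) := by
    intro b
    split_ifs with hb
    · rw [lintegral_const_mul _ (by fun_prop)]
      calc lφ b * ∫⁻ a in Ioi (0:ℝ), min (lf a) (ENNReal.ofReal t)
          ≤ lφ b * (A * ENNReal.ofReal t ^ γ) := by
            gcongr
            exact hweak _
        _ = A * (lφ b * ENNReal.ofReal t ^ γ) := by ring
        _ ≤ A * (ENNReal.ofReal t * J (lφ b)) := by
            exact mul_le_mul' le_rfl (lintegral_Ioi_rpow_mul_min_of_le hγ0 hγ ht hb)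
        _ = _ := by ring
    · rw [lintegral_const_mul _ (by fun_prop)]
      calc ENNReal.ofReal t * ∫⁻ a in Ioi (0:ℝ), min (lf a) (lφ b)
          ≤ ENNReal.ofReal t * (A * lφ b ^ γ) := by
            gcongr
            exact hweak _
        _ ≤ ENNReal.ofReal t * (A * J (lφ b)) := by
            gcongr
            exact lintegral_Ioi_rpow_mul_min_of_lt hγ0 hγ ht (not_le.1 hb)
        _ = _ := by ring
  have hJm : Measurable fun z : ℝ × ℝ => W z.2 * min (lφ z.1) (ENNReal.ofReal z.2) := by fun_prop
  have hJ : ∫⁻ b in Ioi (0:ℝ), J (lφ b) ≤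
      ∫⁻ s in Ioi t, ENNReal.ofReal s ^ γ * maxFn volume φ s * (ENNReal.ofReal s)⁻¹ := by
    rw [lintegral_lintegral_swap hJm.aemeasurable]
    refine setLIntegral_mono' measurableSet_Ioi fun s hs => ?_
    have hs0 : 0 < s := ht.trans hs
    rw [lintegral_const_mul _ (by fun_prop)]
    calc W s * ∫⁻ b in Ioi (0:ℝ), min (lφ b) (ENNReal.ofReal s)
        ≤ W s * (ENNReal.ofReal s * maxFn volume φ s) := by
          gcongr
          exact lintegral_min_distrib_le_maxFn volume φ hs0
      _ = ENNReal.ofReal s * ENNReal.ofReal s ^ (-(1 - γ)) * maxFn volume φ s *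
            (ENNReal.ofReal s)⁻¹ := by
          simp only [hW]
          ring
      _ = _ := by rw [hpow s hs0]
  calc maxFn volume (conv f φ) t
      ≤ (ENNReal.ofReal t)⁻¹ * ∫⁻ b in Ioi (0:ℝ), A * ENNReal.ofReal t * J (lφ b) := by
        rw [maxFn]
        exact mul_le_mul' le_rfl ((lintegral_rearr_conv_le hf hφ ht).trans (lintegral_mono hinner))
    _ = (ENNReal.ofReal t)⁻¹ * (A * ENNReal.ofReal t * ∫⁻ b in Ioi (0:ℝ), J (lφ b)) := by
        rw [lintegral_const_mul (f := fun b => J (lφ b)) _ hJm.lintegral_prod_right']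
    _ = ((ENNReal.ofReal t)⁻¹ * ENNReal.ofReal t) * A * ∫⁻ b in Ioi (0:ℝ), J (lφ b) := by ring
    _ = A * ∫⁻ b in Ioi (0:ℝ), J (lφ b) := by
        rw [ENNReal.inv_mul_cancel ht0 (by finiteness), one_mul]
    _ ≤ _ := by gcongr

/-- If `0 < α < n/p`, `1 ≤ p < ∞`, `1 ≤ q ≤ ∞`, `f ∈ L^{n/(n-α),∞}(ℝⁿ)` and
`φ ∈ L^{p,q}(ℝⁿ)`, then `f∗φ ∈ L^{r,q}(ℝⁿ)` where `1/r = 1/p - α/n`, and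
`‖f∗φ‖_{r,q} ≤ 3 r ‖f‖_{n/(n-α),∞} ‖φ‖_{p,q}`. -/
theorem frac_conv_lorentz (n : ℕ)
    (f φ : EuclideanSpace ℝ (Fin n) → ℝ) (hf : Measurable f) (hφ : Measurable φ)
    (α p r : ℝ) (q : ℝ≥0∞)
    (hp : 1 ≤ p) (hq : 1 ≤ q)
    (hα : 0 < α) (hαp : α < (n:ℝ) / p)
    (hr : 1 / r = 1 / p - α / (n:ℝ))
    (hfL : lorentzNorm volume f ((n:ℝ) / ((n:ℝ) - α)) ⊤ < ⊤)
    (hφL : lorentzNorm volume φ p q < ⊤) :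
    lorentzNorm volume (conv f φ) r q < ⊤ ∧
      lorentzNorm volume (conv f φ) r q ≤
        ENNReal.ofReal (3 * r) * lorentzNorm volume f ((n:ℝ) / ((n:ℝ) - α)) ⊤ *
          lorentzNorm volume φ p q := by
  have hp0 : 0 < p := by linarith
  have hn : (0:ℝ) < n := by
    by_contra! h
    exact absurd (hα.trans hαp) (div_nonpos_of_nonpos_of_nonneg h hp0.le).not_gt
  have hαn : α < n := hαp.trans_le (div_le_self hn.le hp)
  have hr' : 0 < 1 / r := by
    rw [hr, sub_pos, div_lt_div_iff₀ hn hp0, one_mul]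
    exact (lt_div_iff₀ hp0).1 hαp
  have hr0 : 0 < r := one_div_pos.1 hr'
  set γ := α / (n:ℝ) with hγdef
  have hγ0 : 0 < γ := div_pos hα hn
  have hγ1 : γ < 1 := (div_lt_one hn).2 hαn
  set β := 1 / r with hβdef
  have hrβ : 1 / β = r := one_div_one_div r
  have hexp : 1 / ((n:ℝ) / ((n:ℝ) - α)) = 1 - γ := by
    rw [one_div_div, hγdef, sub_div, div_self hn.ne']
  set A := lorentzNorm volume f ((n:ℝ) / ((n:ℝ) - α)) ⊤ with hAdef
  have hA : ∀ t : ℝ, 0 < t → ENNReal.ofReal t ^ (1 - γ) * maxFn volume f t ≤ A := by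
    intro t ht
    rw [hAdef, lorentzNorm, if_pos rfl, hexp]
    exact le_iSup₂_of_le t ht le_rfl
  set K : ℝ → ℝ≥0∞ := fun s => ENNReal.ofReal s ^ (1 / p) * maxFn volume φ s with hKdef
  have hK : Measurable K := by
    have := measurable_maxFn volume φ
    fun_prop
  set w : ℝ → ℝ≥0∞ := fun s => ENNReal.ofReal s ^ (-β) * (ENNReal.ofReal s)⁻¹ with hw
  have hmax : ∀ t : ℝ, 0 < t → ENNReal.ofReal t ^ β * maxFn volume (conv f φ) t ≤
      A * (ENNReal.ofReal t ^ β * ∫⁻ s in Ioi t, K s * w s) := by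
    intro t ht
    rw [mul_left_comm]
    refine mul_le_mul' le_rfl ((maxFn_conv_le hf hφ hγ0 hγ1 hA ht).trans_eq ?_)
    congr 1
    refine setLIntegral_congr_fun measurableSet_Ioi fun s hs => ?_
    have hs0 : 0 < s := ht.trans hs
    have h1 : ENNReal.ofReal s ^ (1 / p) * ENNReal.ofReal s ^ (-β) = ENNReal.ofReal s ^ γ := by
      rw [← ENNReal.rpow_add _ _ (by simpa using hs0) (by finiteness)]
      congr 1
      linarith
    simp only [hKdef, hw]
    rw [← h1]
    ring
  have hbound : lorentzNorm volume (conv f φ) r q ≤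
      ENNReal.ofReal r * A * lorentzNorm volume φ p q := by
    by_cases hqt : q = ⊤
    · rw [lorentzNorm, lorentzNorm, if_pos hqt, if_pos hqt]
      set B := ⨆ (t : ℝ) (_ : 0 < t), ENNReal.ofReal t ^ (1 / p) * maxFn volume φ t
      refine iSup₂_le fun t ht => (hmax t ht).trans ?_
      have hB : ∫⁻ s in Ioi t, K s * w s ≤ B * (ENNReal.ofReal t ^ (-β) * ENNReal.ofReal r) := by
        rw [← hrβ, ← lintegral_Ioi_rpow_mul_inv hr' ht, ← lintegral_const_mul _ (by fun_prop)]
        refine setLIntegral_mono' measurableSet_Ioi fun s hs => ?_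
        exact mul_le_mul' (le_iSup₂_of_le s (ht.trans hs) le_rfl) le_rfl
      have h1 : ENNReal.ofReal t ^ β * ENNReal.ofReal t ^ (-β) = 1 := by
        rw [← ENNReal.rpow_add _ _ (by simpa using ht) (by finiteness)]
        simp
      calc A * (ENNReal.ofReal t ^ β * ∫⁻ s in Ioi t, K s * w s)
          ≤ A * (ENNReal.ofReal t ^ β * (B * (ENNReal.ofReal t ^ (-β) * ENNReal.ofReal r))) := by
            gcongr
        _ = (ENNReal.ofReal t ^ β * ENNReal.ofReal t ^ (-β)) * (ENNReal.ofReal r * A * B) := by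
            ring
        _ = _ := by rw [h1, one_mul]
    · rw [lorentzNorm, lorentzNorm, if_neg hqt, if_neg hqt]
      have hQ : 1 ≤ q.toReal := by
        rw [← ENNReal.toReal_one]
        exact ENNReal.toReal_mono hqt hq
      set Q := q.toReal
      have hQ0 : 0 < Q := by linarith
      rw [one_div Q, ENNReal.rpow_inv_le_iff hQ0, ENNReal.mul_rpow_of_nonneg _ _ hQ0.le,
        ENNReal.mul_rpow_of_nonneg _ _ hQ0.le, ← ENNReal.rpow_mul, inv_mul_cancel₀ hQ0.ne',
        ENNReal.rpow_one]
      have hmeas : Measurable fun t => (ENNReal.ofReal t ^ β * ∫⁻ s in Ioi t, K s * w s) := by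
        have : Antitone fun t : ℝ => ∫⁻ s in Ioi t, K s * w s :=
          fun s t hst => lintegral_mono_set (Ioi_subset_Ioi hst)
        have := this.measurable
        fun_prop
      calc ∫⁻ t in Ioi (0:ℝ), (ENNReal.ofReal t ^ β * maxFn volume (conv f φ) t) ^ Q *
              (ENNReal.ofReal t)⁻¹
          ≤ ∫⁻ t in Ioi (0:ℝ), A ^ Q * ((ENNReal.ofReal t ^ β * ∫⁻ s in Ioi t, K s * w s) ^ Q *
              (ENNReal.ofReal t)⁻¹) := by
            refine setLIntegral_mono' measurableSet_Ioi fun t ht => ?_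
            rw [← mul_assoc, ← ENNReal.mul_rpow_of_nonneg _ _ hQ0.le]
            exact mul_le_mul' (ENNReal.rpow_le_rpow (hmax t ht) hQ0.le) le_rfl
        _ = A ^ Q * ∫⁻ t in Ioi (0:ℝ), (ENNReal.ofReal t ^ β * ∫⁻ s in Ioi t, K s * w s) ^ Q *
              (ENNReal.ofReal t)⁻¹ := lintegral_const_mul _ (by fun_prop)
        _ ≤ A ^ Q * (ENNReal.ofReal (1 / β) ^ Q *
              ∫⁻ s in Ioi (0:ℝ), K s ^ Q * (ENNReal.ofReal s)⁻¹) := by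
            gcongr
            exact lintegral_hardy_le hK hr' hQ
        _ = _ := by
            rw [hrβ]
            ring
  have hbound3 : lorentzNorm volume (conv f φ) r q ≤
      ENNReal.ofReal (3 * r) * A * lorentzNorm volume φ p q := by
    refine hbound.trans ?_
    gcongr
    linarith
  exact ⟨hbound3.trans_lt (by finiteness), hbound3⟩
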